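/- arXiv:2412.08759 — 3 statements merged into one kernel-verified Lean document; each statement's English description precedes it below -/
import Mathlib

section
/- Let s ≥ 0, 9/20 < b < 1/2, and let a, β satisfy 1/2 < β < a ≤ (5/2)b - 5/8. Then sup over (ξ,τ) ∈ ℝ² of ∫∫_{ℝ²} (1+|ξ|)^{2a} · [(1+|τ+ξ²|)^{2b} (1+|τ₁+ξ₁²|)^{2b} (1+|τ-τ₁+(ξ-ξ₁)⁵|)^{2b} (1+|ξ₁|)^{2β}]^{-1} dξ₁ dτ₁ is finite. -/
open MeasureTheory

/-- A function that expands distances on `E` is bounded below, up to constants, by the distance to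
a point of `E` where its absolute value is almost minimal. -/
lemma exists_near_minimizer_of_expanding (E : Set ℝ) (f : ℝ → ℝ) (L : ℝ)
    (h : ∀ x ∈ E, ∀ y ∈ E, L * |x - y| ≤ |f x - f y|) :
    ∃ p, ∀ x ∈ E, p ∈ E ∧ 1 + L * |x - p| ≤ 2 * (1 + |f x|) := by
  rcases E.eq_empty_or_nonempty with rfl | hE
  · exact ⟨0, by simp⟩
  set S := Set.image (fun x => |f x|) E with hS
  have hne : S.Nonempty := hE.image _
  have hbdd : BddBelow S := ⟨0, by rintro _ ⟨x, -, rfl⟩; exact abs_nonneg _⟩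
  obtain ⟨_, ⟨p, hp, rfl⟩, hlt⟩ :=
    exists_lt_of_csInf_lt hne (lt_add_one (sInf S))
  refine ⟨p, fun x hx => ⟨hp, ?_⟩⟩
  have h1 : sInf S ≤ |f x| := csInf_le hbdd ⟨x, hx, rfl⟩
  have h2 := h x hx p hp
  have h3 := abs_sub (f x) (f p)
  simp only at hlt
  linarith

/-- If `|ξ| = t ^ 4` and `|m|` is small compared to `t ^ 5`, the resonance function
`m + 2 ξ η + η² - η⁵` is of size at least `t ^ 5 / 8` except near at most three points,
where it grows at rate `t ^ 4`. -/
lemma resonance_lower_bound (ξ m t : ℝ) (ht : 2 ≤ t) (hξ : |ξ| = t ^ 4) (hm : |m| ≤ t ^ 5 / 8) :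
    ∃ p₁ p₂ p₃ : ℝ, ∀ η : ℝ, t ^ 5 / 8 ≤ |m + 2 * ξ * η + η ^ 2 - η ^ 5| ∨
      (|η| ≤ 2 * t ∧ ∃ p, (p = p₁ ∨ p = p₂ ∨ p = p₃) ∧ |η - p| ≤ 4 * t ∧
        1 + t ^ 4 * |η - p| ≤ 2 * (1 + |m + 2 * ξ * η + η ^ 2 - η ^ 5|)) := by
  set f : ℝ → ℝ := fun η => m + 2 * ξ * η + η ^ 2 - η ^ 5 with hf
  have ht3 : 8 ≤ t ^ 3 := by
    calc (8 : ℝ) = 2 ^ 3 := by norm_num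
      _ ≤ t ^ 3 := by gcongr
  have ht4 : 8 * t ≤ t ^ 4 := by nlinarith
  have key : ∀ x y : ℝ, t ^ 4 ≤ |2 * ξ + x + y - (x^4 + x^3*y + x^2*y^2 + x*y^3 + y^4)| →
      t ^ 4 * |x - y| ≤ |f x - f y| := by
    intro x y h
    have : f x - f y = (2 * ξ + x + y - (x^4 + x^3*y + x^2*y^2 + x*y^3 + y^4)) * (x - y) := by
      simp only [hf]; ring
    rw [this, abs_mul]
    gcongr
  have hξ' : ξ = t ^ 4 ∨ ξ = - t ^ 4 := by
    rcases abs_choice ξ with h | h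
    · left; linarith
    · right; linarith
  have hξle : ξ ≤ t ^ 4 := hξ ▸ le_abs_self ξ
  have hpow : ∀ x : ℝ, t ≤ x → t ^ 4 ≤ x ^ 4 ∧ 8 * x ≤ x ^ 4 := by
    intro x hx
    refine ⟨by gcongr, ?_⟩
    have : 8 ≤ x ^ 3 := ht3.trans (by gcongr)
    nlinarith
  have hmix : ∀ x y : ℝ, t ≤ x → t ≤ y → t ^ 4 ≤ x ^ 3 * y ∧ t ^ 4 ≤ x ^ 2 * y ^ 2 := by
    intro x y hx hy
    have h0 : 0 ≤ t := by linarith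
    have hx0 : 0 ≤ x := by linarith
    constructor
    · calc t ^ 4 = t ^ 3 * t := by ring
        _ ≤ x ^ 3 * y := by gcongr
    · calc t ^ 4 = t ^ 2 * t ^ 2 := by ring
        _ ≤ x ^ 2 * y ^ 2 := by gcongr
  obtain ⟨p₁, h₁⟩ := exists_near_minimizer_of_expanding {x | |x| ≤ t / 2} f (t ^ 4) (by
    intro x hx y hy
    apply key
    simp only [Set.mem_ofPred_eq] at hx hy
    have hmon : ∀ i j : ℕ, i + j = 4 → |x ^ i * y ^ j| ≤ t ^ 4 / 16 := by
      intro i j hij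
      rw [abs_mul, abs_pow, abs_pow]
      calc |x| ^ i * |y| ^ j ≤ (t / 2) ^ i * (t / 2) ^ j := by gcongr
        _ = (t / 2) ^ 4 := by rw [← pow_add, hij]
        _ = t ^ 4 / 16 := by ring
    have a0 := abs_le.1 (hmon 4 0 rfl)
    have a1 := abs_le.1 (hmon 3 1 rfl)
    have a2 := abs_le.1 (hmon 2 2 rfl)
    have a3 := abs_le.1 (hmon 1 3 rfl)
    have a4 := abs_le.1 (hmon 0 4 rfl)
    simp only [pow_zero, pow_one, mul_one, one_mul] at a0 a1 a2 a3 a4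
    have hx' := abs_le.1 hx
    have hy' := abs_le.1 hy
    rw [le_abs]
    rcases hξ' with h | h
    · left; linarith
    · right; linarith)
  obtain ⟨p₂, h₂⟩ := exists_near_minimizer_of_expanding {x | t ≤ x ∧ x ≤ 2 * t} f (t ^ 4) (by
    rintro x ⟨hx, -⟩ y ⟨hy, -⟩
    apply key
    rw [le_abs]
    right
    have a1 := hpow x hx
    have a2 := hpow y hy
    have a3 := hmix x y hx hy
    have a4 := hmix y x hy hx
    linarith)
  obtain ⟨p₃, h₃⟩ := exists_near_minimizer_of_expanding {x | t ≤ -x ∧ -x ≤ 2 * t} f (t ^ 4) (by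
    rintro x ⟨hx, -⟩ y ⟨hy, -⟩
    apply key
    rw [le_abs]
    right
    have a1 := hpow (-x) hx
    have a2 := hpow (-y) hy
    have a3 := hmix (-x) (-y) hx hy
    have a4 := hmix (-y) (-x) hy hx
    ring_nf at a1 a2 a3 a4 ⊢
    linarith)
  refine ⟨p₁, p₂, p₃, fun η => ?_⟩
  have far : t ^ 5 / 4 ≤ |η * (2 * ξ + η - η ^ 4)| → t ^ 5 / 8 ≤ |f η| := by
    intro h
    have e : η * (2 * ξ + η - η ^ 4) = f η - m := by simp only [hf]; ring
    rw [e] at h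
    have := abs_sub (f η) m
    linarith
  have he := le_abs_self η
  have he' := neg_abs_le η
  have hab4 : η ^ 4 = |η| ^ 4 := by rw [← abs_pow, abs_of_nonneg (by positivity)]
  rcases le_or_gt |η| (t / 2) with hη | hη
  · obtain ⟨hp, hp'⟩ := h₁ η hη
    refine Or.inr ⟨by linarith, p₁, by simp, ?_, hp'⟩
    have := abs_sub η p₁
    simp only [Set.mem_ofPred_eq] at hp
    linarith
  rcases lt_or_ge |η| t with hη2 | hη2
  · left
    apply far
    have : η ^ 4 ≤ t ^ 4 := by rw [hab4]; gcongr
    have h0 : 0 ≤ η ^ 4 := by positivity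
    have : t ^ 4 / 2 ≤ |2 * ξ + η - η ^ 4| := by
      rw [le_abs]
      rcases hξ' with h | h
      · left; linarith
      · right; linarith
    rw [abs_mul]
    calc t ^ 5 / 4 = (t / 2) * (t ^ 4 / 2) := by ring
      _ ≤ _ := by gcongr
  rcases lt_or_ge (2 * t) |η| with hη3 | hη3
  · left
    apply far
    have h1 : 16 * t ^ 4 ≤ η ^ 4 := by
      rw [hab4]
      calc 16 * t ^ 4 = (2 * t) ^ 4 := by ring
        _ ≤ _ := by gcongr
    have h2 := (hpow |η| hη2).2
    rw [← hab4] at h2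
    have : t ^ 4 / 2 ≤ |2 * ξ + η - η ^ 4| := by
      rw [le_abs]
      right
      linarith
    rw [abs_mul]
    calc t ^ 5 / 4 = (t / 2) * (t ^ 4 / 2) := by ring
      _ ≤ _ := by gcongr
  · right
    refine ⟨hη3, ?_⟩
    rcases abs_choice η with h | h
    · obtain ⟨hp, hp'⟩ := h₂ η ⟨by linarith, by linarith⟩
      refine ⟨p₂, by simp, ?_, hp'⟩
      have h1 := hp.1
      have h2 := hp.2
      rw [abs_le]
      constructor <;> linarith
    · obtain ⟨hp, hp'⟩ := h₃ η ⟨by linarith, by linarith⟩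
      refine ⟨p₃, by simp, ?_, hp'⟩
      have h1 := hp.1
      have h2 := hp.2
      rw [abs_le]
      constructor <;> linarith

lemma integrable_abs_rpow_mul_one_add_abs_rpow (p q : ℝ) (hp0 : 0 ≤ p) (hp : p < 1)
    (hq : 0 ≤ q) (hpq : 1 < p + q) :
    Integrable (fun y : ℝ => |y| ^ (-p) * (1 + |y|) ^ (-q)) := by
  have hint : IntegrableOn (fun y : ℝ => |y| ^ (-p)) (Set.Icc (-1) 1) := by
    have h1 : IntegrableOn (fun y : ℝ => |y| ^ (-p)) (Set.Ioc 0 1) := by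
      have := (intervalIntegral.intervalIntegrable_rpow' (a := 0) (b := 1) (r := -p) (by linarith)).1
      refine this.congr_fun (fun y hy => ?_) measurableSet_Ioc
      simp only [abs_of_pos hy.1]
    have h2 : IntervalIntegrable (fun y : ℝ => |y| ^ (-p)) volume 0 1 :=
      (intervalIntegrable_iff_integrableOn_Ioc_of_le zero_le_one).2 h1
    have h3 := (h2.comp_mul_left (c := -1)).symm
    simp at h3
    have h4 := h3.trans h2
    rwa [intervalIntegrable_iff_integrableOn_Icc_of_le (by norm_num)] at h4
  have hdec : Integrable (fun y : ℝ => 2 ^ p * (1 + |y|) ^ (-(p + q))) :=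
    (integrable_one_add_norm (E := ℝ) (μ := volume) (by simpa using hpq)).const_mul _
  refine ((hint.integrable_indicator measurableSet_Icc).add hdec).mono' ?_ ?_
  · exact ((measurable_norm.pow_const _).mul
      ((measurable_norm.const_add 1).pow_const _)).aestronglyMeasurable
  · refine Filter.Eventually.of_forall fun y => ?_
    rw [Real.norm_of_nonneg (by positivity)]
    simp only [Pi.add_apply]
    by_cases hy : y ∈ Set.Icc (-1 : ℝ) 1
    · rw [Set.indicator_of_mem hy]
      have : (1 + |y|) ^ (-q) ≤ 1 :=
        Real.rpow_le_one_of_one_le_of_nonpos (by linarith [abs_nonneg y]) (neg_nonpos.2 hq)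
      have h0 : 0 ≤ 2 ^ p * (1 + |y|) ^ (-(p + q)) := by positivity
      have h1 : |y| ^ (-p) * (1 + |y|) ^ (-q) ≤ |y| ^ (-p) * 1 := by gcongr
      linarith
    · rw [Set.indicator_of_notMem hy, zero_add]
      have h1 : 1 < |y| := by
        by_contra! h
        exact hy (abs_le.1 h)
      have h2 : |y| ^ (-p) ≤ ((1 + |y|) / 2) ^ (-p) :=
        Real.rpow_le_rpow_of_nonpos (by positivity) (by linarith) (by linarith)
      rw [Real.div_rpow (by positivity) (by norm_num), Real.rpow_neg (by norm_num : (0:ℝ) ≤ 2),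
        div_inv_eq_mul] at h2
      rw [neg_add, Real.rpow_add (by positivity)]
      calc _ ≤ (1 + |y|) ^ (-p) * 2 ^ p * (1 + |y|) ^ (-q) := by gcongr
        _ = _ := by ring

lemma abs_rpow_mul_add_abs_rpow_scaling (p M x : ℝ) (hM : 0 < M) :
    |x| ^ (-p) * (M + |x|) ^ (-p) =
      M ^ (-(2 * p)) * (|x / M| ^ (-p) * (1 + |x / M|) ^ (-p)) := by
  have h1 : M + |x| = M * (1 + |x / M|) := by
    rw [abs_div, abs_of_pos hM]; field_simp
  have h2 : |x| = M * |x / M| := by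
    rw [abs_div, abs_of_pos hM]; field_simp
  rw [h1]
  nth_rewrite 1 [h2]
  rw [Real.mul_rpow hM.le (abs_nonneg _), Real.mul_rpow hM.le (by positivity),
    show -(2 * p) = -p + -p by ring, Real.rpow_add hM]
  ring

/-- For `u ≤ v` with `u + v ≥ M`, where `u = 1 + |x|`, the larger factor controls `M + |x|`. -/
lemma rpow_mul_rpow_le_of_le (p M x v : ℝ) (hp : 0 < p) (hM : 0 < M) (hx : x ≠ 0)
    (h1 : 1 + |x| ≤ v) (h2 : M ≤ 1 + |x| + v) :
    (1 + |x|) ^ (-p) * v ^ (-p) ≤ 3 ^ p * (|x| ^ (-p) * (M + |x|) ^ (-p)) := by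
  have hx0 : 0 < |x| := abs_pos.2 hx
  have h3 : (1 + |x|) ^ (-p) ≤ |x| ^ (-p) :=
    Real.rpow_le_rpow_of_nonpos hx0 (by linarith) (by linarith)
  have h4 : v ^ (-p) ≤ ((M + |x|) / 3) ^ (-p) :=
    Real.rpow_le_rpow_of_nonpos (by positivity) (by linarith) (by linarith)
  rw [Real.div_rpow (by positivity) (by norm_num), Real.rpow_neg (by norm_num : (0:ℝ) ≤ 3),
    div_inv_eq_mul] at h4
  calc _ ≤ |x| ^ (-p) * ((M + |x|) ^ (-p) * 3 ^ p) := by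
        have : 0 ≤ v := by linarith
        gcongr
    _ = _ := by ring

lemma exists_integral_japanese_bracket_convolution_le (p : ℝ) (hp : 1 / 2 < p) (hp1 : p < 1) :
    ∃ C : ℝ, 0 ≤ C ∧ ∀ A B : ℝ,
      ∫ x : ℝ, (1 + |x + A|) ^ (-p) * (1 + |B - x|) ^ (-p) ≤ C * (1 + |A + B|) ^ (1 - 2 * p) := by
  set G : ℝ → ℝ := fun y => |y| ^ (-p) * (1 + |y|) ^ (-p) with hG
  have hGi : Integrable G :=
    integrable_abs_rpow_mul_one_add_abs_rpow p p (by linarith) hp1 (by linarith) (by linarith)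
  have hG0 : 0 ≤ ∫ y, G y := integral_nonneg fun y => by simp only [hG]; positivity
  refine ⟨3 ^ p * (2 * ∫ y, G y), by positivity, fun A B => ?_⟩
  set M := 1 + |A + B| with hM
  have hM0 : 0 < M := by positivity
  set H : ℝ → ℝ := fun x => M ^ (-(2 * p)) * G (x / M) with hH
  have hHi : Integrable H := (hGi.comp_div hM0.ne').const_mul _
  have hHint : ∫ x, H x = M ^ (1 - 2 * p) * ∫ y, G y := by
    simp only [hH]
    rw [integral_const_mul, Measure.integral_comp_div, abs_of_pos hM0, smul_eq_mul, ← mul_assoc,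
      sub_eq_add_neg, Real.rpow_add hM0, Real.rpow_one, mul_comm (M ^ (-(2 * p)))]
  have hmaj : Integrable (fun x => 3 ^ p * (H (x + A) + H (x - B))) :=
    ((hHi.comp_add_right A).add (hHi.comp_sub_right B)).const_mul _
  calc _ ≤ ∫ x, 3 ^ p * (H (x + A) + H (x - B)) := by
        refine integral_mono_of_nonneg (Filter.Eventually.of_forall fun x => by positivity) hmaj ?_
        filter_upwards [((Set.countable_singleton (-A)).union
          (Set.countable_singleton B)).ae_notMem volume] with x hx
        simp only [Set.mem_union, Set.mem_singleton_iff, not_or] at hx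
        have hxA : x + A ≠ 0 := fun h => hx.1 (by linarith)
        have hxB : x - B ≠ 0 := fun h => hx.2 (by linarith)
        have hsum : M ≤ 1 + |x + A| + (1 + |x - B|) := by
          have := abs_sub (x + A) (x - B)
          rw [show x + A - (x - B) = A + B by ring] at this
          linarith
        have hH0 : ∀ z, 0 ≤ H z := fun z => by simp only [hH, hG]; positivity
        rw [abs_sub_comm B x]
        rcases le_total |x + A| |x - B| with h | h
        · have h1 := rpow_mul_rpow_le_of_le p M (x + A) (1 + |x - B|) (by linarith) hM0 hxA
            (by linarith) hsum
          rw [abs_rpow_mul_add_abs_rpow_scaling p M _ hM0] at h1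
          refine h1.trans ?_
          gcongr
          exact le_add_of_nonneg_right (hH0 _)
        · have h1 := rpow_mul_rpow_le_of_le p M (x - B) (1 + |x + A|) (by linarith) hM0 hxB
            (by linarith) (by linarith)
          rw [abs_rpow_mul_add_abs_rpow_scaling p M _ hM0] at h1
          rw [mul_comm]
          refine h1.trans ?_
          gcongr
          exact le_add_of_nonneg_left (hH0 _)
    _ = _ := by
        rw [integral_const_mul, integral_add (hHi.comp_add_right A) (hHi.comp_sub_right B),
          integral_add_right_eq_self, integral_sub_right_eq_self, hHint]
        ring

/-- If `n` dominates `N ^ (5/4)` up to a constant, its negative power absorbs `N ^ (2 * a)`. -/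
lemma rpow_mul_rpow_neg_le_of_le (a r N n : ℝ) (hN : 1 ≤ N) (hr0 : 0 ≤ r) (hr1 : r ≤ 1)
    (har : 2 * a ≤ 5 / 4 * r) (h : N ^ (5 / 4 : ℝ) / 32 ≤ n) :
    N ^ (2 * a) * n ^ (-r) ≤ 32 := by
  have hN0 : 0 < N := by linarith
  have h1 : n ^ (-r) ≤ (N ^ (5 / 4 : ℝ) / 32) ^ (-r) :=
    Real.rpow_le_rpow_of_nonpos (by positivity) h (by linarith)
  rw [Real.div_rpow (by positivity) (by norm_num), Real.rpow_neg (by norm_num : (0:ℝ) ≤ 32),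
    div_inv_eq_mul, ← Real.rpow_mul hN0.le] at h1
  have h2 : (32 : ℝ) ^ r ≤ 32 := by
    simpa using Real.rpow_le_rpow_of_exponent_le (by norm_num : (1:ℝ) ≤ 32) hr1
  have h3 : N ^ (2 * a + 5 / 4 * -r) ≤ 1 :=
    Real.rpow_le_one_of_one_le_of_nonpos hN (by linarith)
  calc _ ≤ N ^ (2 * a) * (N ^ (5 / 4 * -r) * 32 ^ r) := by gcongr
    _ = N ^ (2 * a + 5 / 4 * -r) * 32 ^ r := by rw [Real.rpow_add hN0]; ring
    _ ≤ 1 * 32 := by gcongr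
    _ = 32 := one_mul _

lemma near_resonance_bound (a β r N y F w : ℝ) (hN : 1 ≤ N) (hβ : 1 / 2 < β) (hβ1 : β ≤ 1)
    (ha : a ≤ 5 / 8) (hr : 3 / 4 ≤ r) (hy : y ≠ 0) (hyN : |y| ≤ 4 * N) (hw : N / 2 ≤ w)
    (hF : 1 ≤ F) (hFy : 1 + N * |y| ≤ 4 * F) :
    N ^ (2 * a) * F ^ (-r) * w ^ (-(2 * β)) ≤ 289 * (|y| ^ (-(1 / 4 : ℝ)) * (1 + |y|) ^ (-1 : ℝ)) := by
  have hN0 : 0 < N := by linarith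
  have hy0 : 0 < |y| := abs_pos.2 hy
  set Z := 1 + N * |y| with hZ
  have hZ0 : 0 < Z := by positivity
  have hw' : w ^ (-(2 * β)) ≤ N ^ (-(2 * β)) * 4 := by
    have h1 : w ^ (-(2 * β)) ≤ (N / 2) ^ (-(2 * β)) :=
      Real.rpow_le_rpow_of_nonpos (by positivity) hw (by linarith)
    rw [Real.div_rpow (by positivity) (by norm_num), Real.rpow_neg (by norm_num : (0:ℝ) ≤ 2),
      div_inv_eq_mul] at h1
    have h2 : (2 : ℝ) ^ (2 * β) ≤ 2 ^ (2 : ℝ) :=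
      Real.rpow_le_rpow_of_exponent_le (by norm_num) (by linarith)
    norm_num at h2
    refine h1.trans ?_
    gcongr
  have hNN : N ^ (2 * a) * N ^ (-(2 * β)) ≤ N ^ (1 / 4 : ℝ) := by
    rw [← Real.rpow_add hN0]
    exact Real.rpow_le_rpow_of_exponent_le hN (by linarith)
  have hF' : F ^ (-r) ≤ 4 * (Z ^ (-(1 / 4 : ℝ)) * Z ^ (-(1 / 2 : ℝ))) := by
    have h1 : F ^ (-r) ≤ F ^ (-(3 / 4 : ℝ)) :=
      Real.rpow_le_rpow_of_exponent_le hF (by linarith)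
    have h2 : F ^ (-(3 / 4 : ℝ)) ≤ (Z / 4) ^ (-(3 / 4 : ℝ)) :=
      Real.rpow_le_rpow_of_nonpos (by positivity) (by linarith) (by norm_num)
    rw [Real.div_rpow hZ0.le (by norm_num), Real.rpow_neg (by norm_num : (0:ℝ) ≤ 4),
      div_inv_eq_mul] at h2
    have h3 : (4 : ℝ) ^ (3 / 4 : ℝ) ≤ 4 := by
      simpa using Real.rpow_le_rpow_of_exponent_le (by norm_num : (1:ℝ) ≤ 4)
        (by norm_num : (3 / 4 : ℝ) ≤ 1)
    rw [← Real.rpow_add hZ0, show -(1 / 4 : ℝ) + -(1 / 2) = -(3 / 4) by norm_num, mul_comm]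
    refine (h1.trans h2).trans ?_
    gcongr
  have hZ1 : N ^ (1 / 4 : ℝ) * Z ^ (-(1 / 4 : ℝ)) ≤ |y| ^ (-(1 / 4 : ℝ)) := by
    have h1 : Z ^ (-(1 / 4 : ℝ)) ≤ (N * |y|) ^ (-(1 / 4 : ℝ)) :=
      Real.rpow_le_rpow_of_nonpos (by positivity) (by linarith) (by norm_num)
    rw [Real.mul_rpow hN0.le hy0.le] at h1
    calc _ ≤ N ^ (1 / 4 : ℝ) * (N ^ (-(1 / 4 : ℝ)) * |y| ^ (-(1 / 4 : ℝ))) := by gcongr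
      _ = _ := by rw [← mul_assoc, ← Real.rpow_add hN0]; simp
  have hZ2 : Z ^ (-(1 / 2 : ℝ)) ≤ 4 * (1 + |y|) ^ (-1 : ℝ) := by
    have h1 : Z ^ (-(1 / 2 : ℝ)) ≤ (((1 + |y|) / 4) ^ (2 : ℝ)) ^ (-(1 / 2 : ℝ)) := by
      refine Real.rpow_le_rpow_of_nonpos (by positivity) ?_ (by norm_num)
      rw [Real.rpow_two]
      nlinarith
    rw [← Real.rpow_mul (by positivity), show (2 : ℝ) * -(1 / 2) = -1 by norm_num] at h1
    refine h1.trans (le_of_eq ?_)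
    rw [Real.rpow_neg_one, Real.rpow_neg_one]
    field_simp
  calc N ^ (2 * a) * F ^ (-r) * w ^ (-(2 * β))
      ≤ N ^ (2 * a) * (4 * (Z ^ (-(1 / 4 : ℝ)) * Z ^ (-(1 / 2 : ℝ)))) * (N ^ (-(2 * β)) * 4) := by
        have : 0 ≤ w := by linarith
        gcongr
    _ = 16 * ((N ^ (2 * a) * N ^ (-(2 * β))) * Z ^ (-(1 / 4 : ℝ)) * Z ^ (-(1 / 2 : ℝ))) := by ring
    _ ≤ 16 * (N ^ (1 / 4 : ℝ) * Z ^ (-(1 / 4 : ℝ)) * Z ^ (-(1 / 2 : ℝ))) := by gcongr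
    _ ≤ 16 * (|y| ^ (-(1 / 4 : ℝ)) * (4 * (1 + |y|) ^ (-1 : ℝ))) := by gcongr
    _ = 64 * (|y| ^ (-(1 / 4 : ℝ)) * (1 + |y|) ^ (-1 : ℝ)) := by ring
    _ ≤ _ := by gcongr; norm_num

/-- After integrating in `τ₁`, the integrand is dominated by a sum of four integrable functions:
the weight `(1 + |x|) ^ (-(2 * β))` and three translates of a fixed function. -/
lemma exists_pointwise_majorant (b a β : ℝ) (hb2 : b < 1/2)
    (hβ : 1/2 < β) (hβa : β < a) (ha : a ≤ (5/2)*b - 5/8) (ξ τ : ℝ) :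
    ∃ p₁ p₂ p₃ : ℝ, ∀ x : ℝ, x ≠ p₁ → x ≠ p₂ → x ≠ p₃ →
      (1 + |ξ|) ^ (2*a) * (1 + |τ + ξ^2|) ^ (-(2*b)) * (1 + |x|) ^ (-(2*β)) *
        (1 + |x^2 + (τ + (ξ - x)^5)|) ^ (1 - 2*(2*b)) ≤
      289 * ((1 + |x|) ^ (-(2*β)) +
        (|x - p₁| ^ (-(1 / 4 : ℝ)) * (1 + |x - p₁|) ^ (-1 : ℝ) +
          |x - p₂| ^ (-(1 / 4 : ℝ)) * (1 + |x - p₂|) ^ (-1 : ℝ) +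
          |x - p₃| ^ (-(1 / 4 : ℝ)) * (1 + |x - p₃|) ^ (-1 : ℝ))) := by
  set N := 1 + |ξ| with hN
  set m := τ + ξ ^ 2 with hm
  have hN1 : 1 ≤ N := by linarith [abs_nonneg ξ]
  have hm1 : (1 + |m|) ^ (-(2*b)) ≤ 1 :=
    Real.rpow_le_one_of_one_le_of_nonpos (by linarith [abs_nonneg m]) (by linarith)
  have hf1 : ∀ z : ℝ, (1 + |z|) ^ (1 - 2*(2*b)) ≤ 1 := fun z =>
    Real.rpow_le_one_of_one_le_of_nonpos (by linarith [abs_nonneg z]) (by linarith)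
  have triv : ∀ x z g : ℝ, 0 ≤ g → N ^ (2*a) * (1 + |m|) ^ (-(2*b)) *
        (1 + |z|) ^ (1 - 2*(2*b)) ≤ 289 →
      N ^ (2*a) * (1 + |m|) ^ (-(2*b)) * (1 + |x|) ^ (-(2*β)) * (1 + |z|) ^ (1 - 2*(2*b)) ≤
        289 * ((1 + |x|) ^ (-(2*β)) + g) := by
    intro x z g hg h
    have h0 : 0 ≤ (1 + |x|) ^ (-(2*β)) := by positivity
    calc _ = N ^ (2*a) * (1 + |m|) ^ (-(2*b)) * (1 + |z|) ^ (1 - 2*(2*b)) *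
          (1 + |x|) ^ (-(2*β)) := by ring
      _ ≤ 289 * (1 + |x|) ^ (-(2*β)) := by gcongr
      _ ≤ _ := by gcongr; exact le_add_of_nonneg_right hg
  rcases lt_or_ge |ξ| 16 with hξ | hξ
  · refine ⟨0, 0, 0, fun x _ _ _ => triv _ _ _ (by positivity) ?_⟩
    have h1 : N ^ (2*a) ≤ 289 := by
      calc N ^ (2*a) ≤ N ^ (2:ℝ) := Real.rpow_le_rpow_of_exponent_le hN1 (by linarith)
        _ = N ^ 2 := Real.rpow_two N
        _ ≤ 17 ^ 2 := by gcongr; linarith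
        _ = 289 := by norm_num
    refine (mul_le_mul (mul_le_mul h1 hm1 (by positivity) (by norm_num)) (hf1 _) (by positivity)
      (by norm_num)).trans (by norm_num)
  obtain ⟨t, ht, hξt⟩ : ∃ t : ℝ, 2 ≤ t ∧ |ξ| = t ^ 4 := by
    have h0 : (|ξ| ^ (1 / 4 : ℝ)) ^ 4 = |ξ| := by
      rw [← Real.rpow_natCast, ← Real.rpow_mul (abs_nonneg _)]
      norm_num
    refine ⟨|ξ| ^ (1 / 4 : ℝ), ?_, h0.symm⟩
    refine le_of_pow_le_pow_left₀ (by norm_num : 4 ≠ 0) (by positivity) ?_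
    rw [h0]
    linarith
  have ht0 : 0 ≤ t := by linarith
  have hNt : N ≤ 2 * t ^ 4 := by linarith
  have ht4 : 8 * t ≤ t ^ 4 := by
    have : (2 : ℝ) ^ 3 ≤ t ^ 3 := by gcongr
    nlinarith
  have hN54 : N ^ (5 / 4 : ℝ) / 32 ≤ t ^ 5 / 8 := by
    have h1 : N ^ (5 / 4 : ℝ) ≤ (2 * t ^ 4) ^ (5 / 4 : ℝ) := by gcongr
    have h2 : (t ^ 4) ^ (5 / 4 : ℝ) = t ^ 5 := by
      rw [← Real.rpow_natCast, ← Real.rpow_mul ht0, ← Real.rpow_natCast t 5]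
      norm_num
    have h3 : (2 : ℝ) ^ (5 / 4 : ℝ) ≤ 2 ^ (2 : ℝ) :=
      Real.rpow_le_rpow_of_exponent_le (by norm_num) (by norm_num)
    rw [Real.mul_rpow (by norm_num) (by positivity), h2] at h1
    norm_num at h3
    have h4 : (2 : ℝ) ^ (5 / 4 : ℝ) * t ^ 5 ≤ 4 * t ^ 5 := by gcongr
    linarith
  rcases lt_or_ge (t ^ 5 / 8) |m| with hmt | hmt
  · refine ⟨0, 0, 0, fun x _ _ _ => triv _ _ _ (by positivity) ?_⟩
    have h1 : N ^ (2*a) * (1 + |m|) ^ (-(2*b)) ≤ 32 :=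
      rpow_mul_rpow_neg_le_of_le a (2*b) N _ hN1 (by linarith) (by linarith) (by linarith)
        (by linarith)
    exact (mul_le_mul h1 (hf1 _) (by positivity) (by norm_num)).trans (by norm_num)
  obtain ⟨p₁, p₂, p₃, hp⟩ := resonance_lower_bound ξ m t ht hξt hmt
  refine ⟨ξ + p₁, ξ + p₂, ξ + p₃, fun x hx₁ hx₂ hx₃ => ?_⟩
  have hfx : m + 2 * ξ * (x - ξ) + (x - ξ) ^ 2 - (x - ξ) ^ 5 = x ^ 2 + (τ + (ξ - x) ^ 5) := by
    rw [hm]; ring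
  have hpx := hp (x - ξ)
  rw [hfx] at hpx
  set F := x ^ 2 + (τ + (ξ - x) ^ 5) with hF
  have hexp : 1 - 2 * (2 * b) = -(4 * b - 1) := by ring
  rcases hpx with hbig | ⟨hη, p, hpp, hpη, hpF⟩
  · refine triv _ _ _ (by positivity) ?_
    rw [hexp]
    have h1 : N ^ (2*a) * (1 + |F|) ^ (-(4*b - 1)) ≤ 32 :=
      rpow_mul_rpow_neg_le_of_le a (4*b - 1) N _ hN1 (by linarith) (by linarith) (by linarith)
        (by linarith)
    calc _ = N ^ (2*a) * (1 + |F|) ^ (-(4*b - 1)) * (1 + |m|) ^ (-(2*b)) := by ring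
      _ ≤ 32 * 1 := by gcongr
      _ ≤ 289 := by norm_num
  · have hxp : x ≠ ξ + p := by
      rcases hpp with rfl | rfl | rfl <;> assumption
    rw [sub_sub] at hpη hpF
    have hw : N / 2 ≤ 1 + |x| := by
      have := abs_sub_abs_le_abs_sub ξ x
      rw [abs_sub_comm] at this
      linarith
    have hmain := near_resonance_bound a β (4*b - 1) N (x - (ξ + p)) (1 + |F|) (1 + |x|) hN1 hβ
      (by linarith) (by linarith) (by linarith) (sub_ne_zero.2 hxp) (by linarith) hw
      (by linarith [abs_nonneg F]) (by nlinarith [abs_nonneg (x - (ξ + p))])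
    have hsum : |x - (ξ + p)| ^ (-(1 / 4 : ℝ)) * (1 + |x - (ξ + p)|) ^ (-1 : ℝ) ≤
        (1 + |x|) ^ (-(2*β)) +
        (|x - (ξ + p₁)| ^ (-(1 / 4 : ℝ)) * (1 + |x - (ξ + p₁)|) ^ (-1 : ℝ) +
          |x - (ξ + p₂)| ^ (-(1 / 4 : ℝ)) * (1 + |x - (ξ + p₂)|) ^ (-1 : ℝ) +
          |x - (ξ + p₃)| ^ (-(1 / 4 : ℝ)) * (1 + |x - (ξ + p₃)|) ^ (-1 : ℝ)) := by
      have g0 : ∀ y : ℝ, 0 ≤ |y| ^ (-(1 / 4 : ℝ)) * (1 + |y|) ^ (-1 : ℝ) := fun y => by positivity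
      have hx0 : 0 ≤ (1 + |x|) ^ (-(2*β)) := by positivity
      have g₁ := g0 (x - (ξ + p₁))
      have g₂ := g0 (x - (ξ + p₂))
      have g₃ := g0 (x - (ξ + p₃))
      rcases hpp with rfl | rfl | rfl <;> linarith
    rw [hexp]
    calc _ = N ^ (2*a) * (1 + |F|) ^ (-(4*b - 1)) * (1 + |x|) ^ (-(2*β)) *
          (1 + |m|) ^ (-(2*b)) := by ring
      _ ≤ N ^ (2*a) * (1 + |F|) ^ (-(4*b - 1)) * (1 + |x|) ^ (-(2*β)) * 1 := by gcongr
      _ ≤ _ := by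
        rw [mul_one]
        exact hmain.trans (by gcongr)

theorem stmt_9 (s b a β : ℝ) (hs : 0 ≤ s) (hb1 : 9/20 < b) (hb2 : b < 1/2)
    (hβ : 1/2 < β) (hβa : β < a) (ha : a ≤ (5/2)*b - 5/8) :
    ∃ C : ℝ, ∀ ξ τ : ℝ,
      (∫ ξ₁ : ℝ, ∫ τ₁ : ℝ,
        (1 + |ξ|) ^ (2*a) /
          ((1 + |τ + ξ^2|) ^ (2*b) * (1 + |τ₁ + ξ₁^2|) ^ (2*b) *
            (1 + |τ - τ₁ + (ξ - ξ₁)^5|) ^ (2*b) * (1 + |ξ₁|) ^ (2*β))) ≤ C := by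
  obtain ⟨K, hK0, hK⟩ := exists_integral_japanese_bracket_convolution_le (2*b) (by linarith)
    (by linarith)
  set g : ℝ → ℝ := fun y => |y| ^ (-(1 / 4 : ℝ)) * (1 + |y|) ^ (-1 : ℝ) with hg
  set w : ℝ → ℝ := fun x => (1 + |x|) ^ (-(2*β)) with hw
  have hgi : Integrable g :=
    integrable_abs_rpow_mul_one_add_abs_rpow (1 / 4) 1 (by norm_num) (by norm_num) (by norm_num)
      (by norm_num)
  have hwi : Integrable w :=
    integrable_one_add_norm (E := ℝ) (μ := volume) (by simp; linarith)
  refine ⟨K * (289 * ((∫ x, w x) + 3 * ∫ y, g y)), fun ξ τ => ?_⟩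
  obtain ⟨p₁, p₂, p₃, hp⟩ := exists_pointwise_majorant b a β hb2 hβ hβa ha ξ τ
  have hgs : ∀ p, Integrable fun x => g (x - p) := fun p => hgi.comp_sub_right p
  have hg12 : Integrable fun x => g (x - p₁) + g (x - p₂) := (hgs p₁).add (hgs p₂)
  have hg123 : Integrable fun x => g (x - p₁) + g (x - p₂) + g (x - p₃) := hg12.add (hgs p₃)
  have hmaj : Integrable fun x =>
      K * (289 * (w x + (g (x - p₁) + g (x - p₂) + g (x - p₃)))) :=
    ((hwi.add hg123).const_mul _).const_mul _
  calc _ ≤ ∫ x, K * (289 * (w x + (g (x - p₁) + g (x - p₂) + g (x - p₃)))) := by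
        refine integral_mono_of_nonneg (Filter.Eventually.of_forall fun x =>
          integral_nonneg fun y => by positivity) hmaj ?_
        filter_upwards [(Set.toFinite {p₁, p₂, p₃}).countable.ae_notMem volume] with x hx
        simp only [Set.mem_insert_iff, Set.mem_singleton_iff, not_or] at hx
        have hfac : ∀ y : ℝ, (1 + |ξ|) ^ (2*a) /
            ((1 + |τ + ξ^2|) ^ (2*b) * (1 + |y + x^2|) ^ (2*b) *
              (1 + |τ - y + (ξ - x)^5|) ^ (2*b) * (1 + |x|) ^ (2*β)) =
            (1 + |ξ|) ^ (2*a) * (1 + |τ + ξ^2|) ^ (-(2*b)) * (1 + |x|) ^ (-(2*β)) *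
              ((1 + |y + x^2|) ^ (-(2*b)) * (1 + |τ + (ξ - x)^5 - y|) ^ (-(2*b))) := by
          intro y
          rw [Real.rpow_neg (by positivity), Real.rpow_neg (by positivity),
            Real.rpow_neg (by positivity), Real.rpow_neg (by positivity),
            show τ - y + (ξ - x)^5 = τ + (ξ - x)^5 - y by ring, div_eq_mul_inv, mul_inv, mul_inv,
            mul_inv]
          ring
        simp only [hfac]
        rw [integral_const_mul]
        calc _ ≤ (1 + |ξ|) ^ (2*a) * (1 + |τ + ξ^2|) ^ (-(2*b)) * (1 + |x|) ^ (-(2*β)) *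
              (K * (1 + |x^2 + (τ + (ξ - x)^5)|) ^ (1 - 2*(2*b))) := by
              gcongr
              exact hK _ _
          _ = K * ((1 + |ξ|) ^ (2*a) * (1 + |τ + ξ^2|) ^ (-(2*b)) * (1 + |x|) ^ (-(2*β)) *
              (1 + |x^2 + (τ + (ξ - x)^5)|) ^ (1 - 2*(2*b))) := by ring
          _ ≤ _ := by
              exact mul_le_mul_of_nonneg_left (hp x hx.1 hx.2.1 hx.2.2) hK0
    _ = _ := by
        rw [integral_const_mul, integral_const_mul, integral_add hwi hg123,
          integral_add hg12 (hgs p₃), integral_add (hgs p₁) (hgs p₂), integral_sub_right_eq_self,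
          integral_sub_right_eq_self, integral_sub_right_eq_self]
        ring
end

section
/- Let s ≥ 0, 3/8 < b < 1/2, 1/2 < β ≤ 2b - 1/4 and 0 ≤ a ≤ 5β - 9/4. Then sup over (ξ,τ) ∈ ℝ² of ∫∫_{ℝ²} |ξ|² (1+|ξ|)^{2a} · [(1+|τ+ξ⁵|)^{2b} (1+|τ₁+ξ₁²|)^{2b} (1+|ξ-ξ₁|)^{2β} (1+|τ-τ₁+(ξ-ξ₁)²|)^{2b} (1+|ξ₁|)^{2β}]^{-1} dξ₁ dτ₁ is finite. -/
open MeasureTheory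

/-- The Japanese bracket `1 + |x|` raised to the power `-r`. -/
noncomputable def bracketDecay (r x : ℝ) : ℝ := (1 + |x|) ^ (-r)

lemma bracketDecay_nonneg (r x : ℝ) : 0 ≤ bracketDecay r x := by
  unfold bracketDecay; positivity

lemma bracketDecay_le_one {r : ℝ} (hr : 0 ≤ r) (x : ℝ) : bracketDecay r x ≤ 1 :=
  Real.rpow_le_one_of_one_le_of_nonpos (by linarith [abs_nonneg x]) (by linarith)

lemma bracketDecay_le_rpow {r : ℝ} (hr : 0 ≤ r) {x m : ℝ} (hm : 0 < m) (h : m ≤ 1 + |x|) :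
    bracketDecay r x ≤ m ^ (-r) :=
  Real.rpow_le_rpow_of_nonpos hm h (by linarith)

lemma integrable_bracketDecay {r : ℝ} (hr : 1 < r) : Integrable (bracketDecay r) := by
  have h := integrable_one_add_norm (E := ℝ) (μ := volume) (r := r) (by simpa using hr)
  simp only [Real.norm_eq_abs] at h
  exact h

lemma bracketDecay_mul_le_of_abs_le {p q x y : ℝ} (hq : 0 ≤ q) (hqp : q ≤ p)
    (h : |y| ≤ |x|) :
    bracketDecay p x * bracketDecay p y ≤
      2 ^ q * bracketDecay q (x + y) * bracketDecay (2 * p - q) y := by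
  unfold bracketDecay
  have hx : 0 < 1 + |x| := by positivity
  have hy : 0 < 1 + |y| := by positivity
  have hxy : 0 < 1 + |x + y| := by positivity
  have h1 : (1 + |x|) ^ (-q) ≤ 2 ^ q * (1 + |x + y|) ^ (-q) := by
    have h2 : (2 * (1 + |x|)) ^ (-q) ≤ (1 + |x + y|) ^ (-q) :=
      Real.rpow_le_rpow_of_nonpos hxy (by linarith [abs_add_le x y]) (by linarith)
    rw [Real.mul_rpow (by norm_num) hx.le, Real.rpow_neg (by norm_num : (0:ℝ) ≤ 2),
      inv_mul_le_iff₀ (by positivity)] at h2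
    exact h2
  have h3 : (1 + |x|) ^ (-(p - q)) ≤ (1 + |y|) ^ (-(p - q)) :=
    Real.rpow_le_rpow_of_nonpos hy (by linarith) (by linarith)
  calc (1 + |x|) ^ (-p) * (1 + |y|) ^ (-p)
      = (1 + |x|) ^ (-q) * ((1 + |x|) ^ (-(p - q)) * (1 + |y|) ^ (-p)) := by
        rw [← mul_assoc, ← Real.rpow_add hx]; congr 2; ring
    _ ≤ (2 ^ q * (1 + |x + y|) ^ (-q)) * ((1 + |y|) ^ (-(p - q)) * (1 + |y|) ^ (-p)) := by
        gcongr
    _ = _ := by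
        rw [← Real.rpow_add hy]; congr 2; ring

lemma bracketDecay_mul_le {p q : ℝ} (hq : 0 ≤ q) (hqp : q ≤ p) (x y : ℝ) :
    bracketDecay p x * bracketDecay p y ≤
      2 ^ q * bracketDecay q (x + y) *
        (bracketDecay (2 * p - q) x + bracketDecay (2 * p - q) y) := by
  have hc : 0 ≤ 2 ^ q * bracketDecay q (x + y) :=
    mul_nonneg (by positivity) (bracketDecay_nonneg _ _)
  rcases le_total |y| |x| with h | h
  · refine (bracketDecay_mul_le_of_abs_le hq hqp h).trans (mul_le_mul_of_nonneg_left ?_ hc)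
    linarith [bracketDecay_nonneg (2 * p - q) x]
  · rw [mul_comm (bracketDecay p x)]
    refine (bracketDecay_mul_le_of_abs_le hq hqp h).trans ?_
    rw [add_comm y x]
    refine mul_le_mul_of_nonneg_left ?_ hc
    linarith [bracketDecay_nonneg (2 * p - q) y]

lemma integral_bracketDecay_mul_le {p q : ℝ} (hq : 0 ≤ q) (hqp : q ≤ p) (hpq : 1 < 2 * p - q)
    (c d : ℝ) :
    ∫ t, bracketDecay p (t + c) * bracketDecay p (d - t) ≤
      2 ^ q * (2 * ∫ t, bracketDecay (2 * p - q) t) * bracketDecay q (c + d) := by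
  have hint := integrable_bracketDecay hpq
  have h1 : Integrable fun t => bracketDecay (2 * p - q) (t + c) := hint.comp_add_right c
  have h2 : Integrable fun t => bracketDecay (2 * p - q) (d - t) := hint.comp_sub_left d
  calc ∫ t, bracketDecay p (t + c) * bracketDecay p (d - t)
      ≤ ∫ t, 2 ^ q * bracketDecay q (c + d) *
          (bracketDecay (2 * p - q) (t + c) + bracketDecay (2 * p - q) (d - t)) := by
        refine integral_mono_of_nonneg (.of_forall fun t =>
          mul_nonneg (bracketDecay_nonneg _ _) (bracketDecay_nonneg _ _))
          ((h1.add h2).const_mul _) (.of_forall fun t => ?_)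
        have h := bracketDecay_mul_le hq hqp (t + c) (d - t)
        rwa [show t + c + (d - t) = c + d by ring] at h
    _ = _ := by
        rw [integral_const_mul, integral_add h1 h2,
          integral_add_right_eq_self (bracketDecay (2 * p - q)) c,
          integral_sub_left_eq_self (bracketDecay (2 * p - q)) volume d]
        ring

lemma bracketDecay_mul_le_of_resonance {p q m x y : ℝ} (hq : 0 ≤ q) (hqp : q ≤ p) (hm : 0 < m)
    (h : m ≤ |x - y|) : bracketDecay p x * bracketDecay q y ≤ m ^ (-q) := by
  have h1 : bracketDecay p x ≤ bracketDecay q x :=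
    Real.rpow_le_rpow_of_exponent_le (by linarith [abs_nonneg x]) (by linarith)
  refine (mul_le_mul_of_nonneg_right h1 (bracketDecay_nonneg _ _)).trans ?_
  unfold bracketDecay
  rw [← Real.mul_rpow (by positivity) (by positivity)]
  refine Real.rpow_le_rpow_of_nonpos hm ?_ (by linarith)
  nlinarith [abs_sub x y, abs_nonneg x, abs_nonneg y, mul_nonneg (abs_nonneg x) (abs_nonneg y)]

lemma le_abs_of_sq_add_sq_large {ξ x y : ℝ} (hξ : 2 ≤ |ξ|) (hsum : x + y = ξ)
    (h : |ξ| ^ 5 / 2 < x ^ 2 + y ^ 2) : |ξ| ^ (5 / 2 : ℝ) / 4 ≤ |x| := by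
  have h5 : (|ξ| ^ (5 / 2 : ℝ)) ^ 2 = |ξ| ^ 5 := by
    rw [← Real.rpow_natCast, ← Real.rpow_mul (abs_nonneg ξ), ← Real.rpow_natCast]
    norm_num
  have h3 : 8 * |ξ| ^ 2 ≤ |ξ| ^ 5 := by
    have : (2 : ℝ) ^ 3 ≤ |ξ| ^ 3 := by gcongr
    nlinarith [sq_nonneg |ξ|]
  refine abs_le_of_sq_le_sq' ?_ (abs_nonneg x) |>.2
  rw [div_pow, h5, sq_abs]
  have h2 : y ^ 2 ≤ 2 * x ^ 2 + 2 * |ξ| ^ 2 := by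
    rw [sq_abs, ← hsum]; nlinarith [sq_nonneg (2 * x + y)]
  linarith [sq_nonneg x]

/-- The `ξ₁`-integrand that remains once `τ₁` has been integrated out. -/
noncomputable def reducedMultiplier (p q r a ξ τ x : ℝ) : ℝ :=
  |ξ| ^ 2 * (1 + |ξ|) ^ (2 * a) *
    (bracketDecay p (τ + ξ ^ 5) * bracketDecay q (x ^ 2 + (τ + (ξ - x) ^ 2))) *
    (bracketDecay r x * bracketDecay r (ξ - x))

lemma sq_mul_bracket_rpow_le {a : ℝ} (ha : 0 ≤ a) {t : ℝ} (ht : 2 ≤ t) :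
    t ^ 2 * (1 + t) ^ (2 * a) ≤ 2 ^ (2 * a) * t ^ (2 + 2 * a) := by
  have ht0 : 0 < t := by linarith
  calc t ^ 2 * (1 + t) ^ (2 * a) ≤ t ^ 2 * (2 * t) ^ (2 * a) := by gcongr; linarith
    _ = _ := by
      rw [Real.mul_rpow (by norm_num) ht0.le, Real.rpow_add ht0, Real.rpow_two]; ring

lemma reducedMultiplier_le_of_small {p q r a ξ : ℝ} (hp : 0 ≤ p) (hq : 0 ≤ q) (hr : 0 ≤ r)
    (ha : 0 ≤ a) (hξ : |ξ| ≤ 2) (τ x : ℝ) :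
    reducedMultiplier p q r a ξ τ x ≤ 2 ^ 2 * 3 ^ (2 * a) * bracketDecay r x := by
  unfold reducedMultiplier
  have h1 : |ξ| ^ 2 * (1 + |ξ|) ^ (2 * a) ≤ 2 ^ 2 * 3 ^ (2 * a) := by
    gcongr; linarith
  have h2 := mul_le_one₀ (bracketDecay_le_one hp (τ + ξ ^ 5)) (bracketDecay_nonneg _ _)
    (bracketDecay_le_one hq (x ^ 2 + (τ + (ξ - x) ^ 2)))
  have h3 := mul_le_of_le_one_right (bracketDecay_nonneg r x) (bracketDecay_le_one hr (ξ - x))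
  have h4 := mul_le_mul h1 h2 (mul_nonneg (bracketDecay_nonneg _ _) (bracketDecay_nonneg _ _))
    (by positivity)
  rw [mul_one] at h4
  exact mul_le_mul h4 h3 (mul_nonneg (bracketDecay_nonneg _ _) (bracketDecay_nonneg _ _))
    (by positivity)

lemma reducedMultiplier_le_of_resonant {p q r a ξ x : ℝ} (hq : 0 ≤ q) (hqp : q ≤ p) (hr : 0 ≤ r)
    (ha : 0 ≤ a) (hexp : 2 + 2 * a - 5 * q - r ≤ 0) (hξ : 2 ≤ |ξ|)
    (hx : x ^ 2 + (ξ - x) ^ 2 ≤ |ξ| ^ 5 / 2) (τ : ℝ) :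
    reducedMultiplier p q r a ξ τ x ≤
      2 ^ (2 * a) * 2 ^ q * 2 ^ r * (bracketDecay r x + bracketDecay r (ξ - x)) := by
  unfold reducedMultiplier
  have ht : 0 < |ξ| := by linarith
  have hsum := add_nonneg (bracketDecay_nonneg r x) (bracketDecay_nonneg r (ξ - x))
  have hres : bracketDecay p (τ + ξ ^ 5) * bracketDecay q (x ^ 2 + (τ + (ξ - x) ^ 2)) ≤
      2 ^ q * |ξ| ^ (-(5 * q)) := by
    have h := bracketDecay_mul_le_of_resonance (m := |ξ| ^ 5 / 2) (x := τ + ξ ^ 5)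
      (y := x ^ 2 + (τ + (ξ - x) ^ 2)) hq hqp (by positivity) (by
        rw [show τ + ξ ^ 5 - (x ^ 2 + (τ + (ξ - x) ^ 2)) = ξ ^ 5 - (x ^ 2 + (ξ - x) ^ 2) by ring]
        have h1 := abs_sub_abs_le_abs_sub (ξ ^ 5) (x ^ 2 + (ξ - x) ^ 2)
        rw [abs_pow, abs_of_nonneg (by positivity : 0 ≤ x ^ 2 + (ξ - x) ^ 2)] at h1
        linarith)
    refine h.trans_eq ?_
    rw [Real.div_rpow (by positivity) (by norm_num), Real.rpow_neg (by norm_num : (0:ℝ) ≤ 2),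
      div_inv_eq_mul, ← Real.rpow_natCast, ← Real.rpow_mul ht.le, mul_comm]
    congr 2; push_cast; ring
  have hprod : bracketDecay r x * bracketDecay r (ξ - x) ≤
      2 ^ r * |ξ| ^ (-r) * (bracketDecay r x + bracketDecay r (ξ - x)) := by
    have h := bracketDecay_mul_le hr le_rfl x (ξ - x)
    rw [show x + (ξ - x) = ξ by ring, show 2 * r - r = r by ring] at h
    refine h.trans ?_
    gcongr
    exact bracketDecay_le_rpow hr ht (by linarith)
  have hnn1 := mul_nonneg (bracketDecay_nonneg p (τ + ξ ^ 5))
    (bracketDecay_nonneg q (x ^ 2 + (τ + (ξ - x) ^ 2)))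
  have hnn2 := mul_nonneg (bracketDecay_nonneg r x) (bracketDecay_nonneg r (ξ - x))
  have hpow : |ξ| ^ (2 + 2 * a) * |ξ| ^ (-(5 * q)) * |ξ| ^ (-r) ≤ 1 := by
    rw [← Real.rpow_add ht, ← Real.rpow_add ht]
    exact Real.rpow_le_one_of_one_le_of_nonpos (by linarith) (by linarith)
  calc _ ≤ (2 ^ (2 * a) * |ξ| ^ (2 + 2 * a)) * (2 ^ q * |ξ| ^ (-(5 * q))) *
        (2 ^ r * |ξ| ^ (-r) * (bracketDecay r x + bracketDecay r (ξ - x))) :=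
        mul_le_mul (mul_le_mul (sq_mul_bracket_rpow_le ha hξ) hres hnn1 (by positivity)) hprod
          hnn2 (by positivity)
    _ = 2 ^ (2 * a) * 2 ^ q * 2 ^ r * (bracketDecay r x + bracketDecay r (ξ - x)) *
        (|ξ| ^ (2 + 2 * a) * |ξ| ^ (-(5 * q)) * |ξ| ^ (-r)) := by ring
    _ ≤ _ := mul_le_of_le_one_right (by positivity) hpow

lemma reducedMultiplier_le_of_far {p q r a ξ x : ℝ} (hp : 0 ≤ p) (hq : 0 ≤ q) (hr : 0 ≤ r)
    (ha : 0 ≤ a) (hexp : 2 + 2 * a + 5 / 2 - 5 * r ≤ 0) (hξ : 2 ≤ |ξ|)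
    (hx : |ξ| ^ 5 / 2 < x ^ 2 + (ξ - x) ^ 2) (τ : ℝ) :
    reducedMultiplier p q r a ξ τ x ≤
      2 ^ (2 * a) * 2 ^ r * 4 ^ (2 * r - 1) *
        ((|ξ| ^ (5 / 2 : ℝ) / 4)⁻¹ * bracketDecay r (x / (|ξ| ^ (5 / 2 : ℝ) / 4))) := by
  unfold reducedMultiplier
  have ht : 0 < |ξ| := by linarith
  have hx1 := le_abs_of_sq_add_sq_large hξ (add_sub_cancel x ξ) hx
  have hx2 := le_abs_of_sq_add_sq_large hξ (sub_add_cancel ξ x) (by rwa [add_comm] at hx)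
  set N := |ξ| ^ (5 / 2 : ℝ) / 4 with hN
  have hN0 : 0 < N := by positivity
  have h1 : bracketDecay r (ξ - x) ≤ N ^ (-r) := bracketDecay_le_rpow hr hN0 (by linarith)
  have h2 : bracketDecay r x ≤ 2 ^ r * N ^ (-r) * bracketDecay r (x / N) := by
    have h := bracketDecay_le_rpow hr (x := x) (m := N / 2 * (1 + |x / N|)) (by positivity) (by
      rw [abs_div, abs_of_pos hN0]
      field_simp
      linarith)
    rwa [Real.mul_rpow (by positivity) (by positivity), Real.div_rpow hN0.le (by norm_num),
      Real.rpow_neg (by norm_num : (0:ℝ) ≤ 2), div_inv_eq_mul, mul_comm (N ^ (-r))] at h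
  have h3 := mul_le_one₀ (bracketDecay_le_one hp (τ + ξ ^ 5)) (bracketDecay_nonneg _ _)
    (bracketDecay_le_one hq (x ^ 2 + (τ + (ξ - x) ^ 2)))
  have hnn1 := mul_nonneg (bracketDecay_nonneg p (τ + ξ ^ 5))
    (bracketDecay_nonneg q (x ^ 2 + (τ + (ξ - x) ^ 2)))
  have hnn2 := bracketDecay_nonneg r x
  have hnn3 := bracketDecay_nonneg r (ξ - x)
  have hnn4 := bracketDecay_nonneg r (x / N)
  have hpow : |ξ| ^ (2 + 2 * a) * (N ^ (-r) * N ^ (-r)) ≤ 4 ^ (2 * r - 1) * N⁻¹ := by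
    have e1 : N ^ (-r) * N ^ (-r) = N ^ (1 - 2 * r) * N⁻¹ := by
      rw [← Real.rpow_neg_one N, ← Real.rpow_add hN0, ← Real.rpow_add hN0]; congr 1; ring
    have e2 : N ^ (1 - 2 * r) = 4 ^ (2 * r - 1) * |ξ| ^ (5 / 2 * (1 - 2 * r)) := by
      rw [hN, Real.div_rpow (by positivity) (by norm_num), ← Real.rpow_mul ht.le,
        show 2 * r - 1 = -(1 - 2 * r) by ring, Real.rpow_neg (by norm_num : (0:ℝ) ≤ 4)]
      field_simp
    have e3 : |ξ| ^ (2 + 2 * a) * |ξ| ^ (5 / 2 * (1 - 2 * r)) ≤ 1 := by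
      rw [← Real.rpow_add ht]
      exact Real.rpow_le_one_of_one_le_of_nonpos (by linarith) (by linarith)
    calc _ = 4 ^ (2 * r - 1) * N⁻¹ * (|ξ| ^ (2 + 2 * a) * |ξ| ^ (5 / 2 * (1 - 2 * r))) := by
          rw [e1, e2]; ring
      _ ≤ _ := mul_le_of_le_one_right (by positivity) e3
  calc _ ≤ (2 ^ (2 * a) * |ξ| ^ (2 + 2 * a)) * 1 *
        ((2 ^ r * N ^ (-r) * bracketDecay r (x / N)) * N ^ (-r)) :=
        mul_le_mul (mul_le_mul (sq_mul_bracket_rpow_le ha hξ) h3 hnn1 (by positivity))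
          (mul_le_mul h2 h1 hnn3 (by positivity)) (mul_nonneg hnn2 hnn3) (by positivity)
    _ = 2 ^ (2 * a) * 2 ^ r * bracketDecay r (x / N) *
        (|ξ| ^ (2 + 2 * a) * (N ^ (-r) * N ^ (-r))) := by ring
    _ ≤ 2 ^ (2 * a) * 2 ^ r * bracketDecay r (x / N) * (4 ^ (2 * r - 1) * N⁻¹) := by gcongr
    _ = _ := by ring

lemma exists_reducedMultiplier_le {p q r a : ℝ} (hq : 0 ≤ q) (hqp : q ≤ p) (hr : 0 ≤ r)
    (ha : 0 ≤ a) (hexp₁ : 2 + 2 * a - 5 * q - r ≤ 0) (hexp₂ : 2 + 2 * a + 5 / 2 - 5 * r ≤ 0) :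
    ∃ C : ℝ, 0 ≤ C ∧ ∀ ξ τ : ℝ, ∃ N : ℝ, 0 < N ∧ ∀ x : ℝ,
      reducedMultiplier p q r a ξ τ x ≤
        C * (bracketDecay r x + bracketDecay r (ξ - x) + N⁻¹ * bracketDecay r (x / N)) := by
  set A : ℝ := 2 ^ 2 * 3 ^ (2 * a)
  set B : ℝ := 2 ^ (2 * a) * 2 ^ q * 2 ^ r
  set D : ℝ := 2 ^ (2 * a) * 2 ^ r * 4 ^ (2 * r - 1)
  have hA : 0 ≤ A := by positivity
  have hB : 0 ≤ B := by positivity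
  have hD : 0 ≤ D := by positivity
  refine ⟨A + B + D, by positivity, fun ξ τ => ?_⟩
  rcases le_total |ξ| 2 with hξ | hξ
  · refine ⟨1, one_pos, fun x => ?_⟩
    refine (reducedMultiplier_le_of_small (hq.trans hqp) hq hr ha hξ τ x).trans ?_
    have h1 := bracketDecay_nonneg r x
    have h2 := bracketDecay_nonneg r (ξ - x)
    have h3 := bracketDecay_nonneg r (x / 1)
    refine mul_le_mul (by linarith) ?_ h1 (by positivity)
    rw [inv_one, one_mul]; linarith
  · have hN : 0 < |ξ| ^ (5 / 2 : ℝ) / 4 := by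
      have : 0 < |ξ| := by linarith
      positivity
    refine ⟨_, hN, fun x => ?_⟩
    have h1 := bracketDecay_nonneg r x
    have h2 := bracketDecay_nonneg r (ξ - x)
    have h3 := mul_nonneg (inv_nonneg.2 hN.le)
      (bracketDecay_nonneg r (x / (|ξ| ^ (5 / 2 : ℝ) / 4)))
    rcases le_or_gt (x ^ 2 + (ξ - x) ^ 2) (|ξ| ^ 5 / 2) with hx | hx
    · exact (reducedMultiplier_le_of_resonant hq hqp hr ha hexp₁ hξ hx τ).trans
        (mul_le_mul (by linarith) (by linarith) (by linarith) (by linarith))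
    · exact (reducedMultiplier_le_of_far (hq.trans hqp) hq hr ha hexp₂ hξ hx τ).trans
        (mul_le_mul (by linarith) (by linarith) (by linarith) (by linarith))

theorem stmt_12 (s b β a : ℝ) (hs : 0 ≤ s) (hb1 : 3/8 < b) (hb2 : b < 1/2)
    (hβ1 : 1/2 < β) (hβ2 : β ≤ 2*b - 1/4) (ha1 : 0 ≤ a) (ha2 : a ≤ 5*β - 9/4) :
    ∃ C : ℝ, ∀ ξ τ : ℝ,
      (∫ ξ₁ : ℝ, ∫ τ₁ : ℝ,
        |ξ|^2 * (1 + |ξ|) ^ (2*a) /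
          ((1 + |τ + ξ^5|) ^ (2*b) * (1 + |τ₁ + ξ₁^2|) ^ (2*b) *
            (1 + |ξ - ξ₁|) ^ (2*β) * (1 + |τ - τ₁ + (ξ - ξ₁)^2|) ^ (2*b) *
            (1 + |ξ₁|) ^ (2*β))) ≤ C := by
  set p := 2 * b with hp
  set r := 2 * β with hr
  set q := 2 * p - 11 / 10 with hq
  obtain ⟨C, hC, hbound⟩ := exists_reducedMultiplier_le (p := p) (q := q) (r := r) (a := a)
    (by linarith) (by linarith) (by linarith) ha1 (by linarith) (by linarith)
  set K : ℝ := 2 ^ q * (2 * ∫ t, bracketDecay (2 * p - q) t)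
  have hK : 0 ≤ K := mul_nonneg (by positivity)
    (mul_nonneg zero_le_two (integral_nonneg fun t => bracketDecay_nonneg _ t))
  have hr1 : 1 < r := by linarith
  have hint := integrable_bracketDecay hr1
  refine ⟨K * C * (3 * ∫ x, bracketDecay r x), fun ξ τ => ?_⟩
  obtain ⟨N, hN, hNbound⟩ := hbound ξ τ
  have i1 : Integrable fun x => bracketDecay r (ξ - x) := hint.comp_sub_left ξ
  have i2 : Integrable fun x => N⁻¹ * bracketDecay r (x / N) :=
    (hint.comp_div hN.ne').const_mul _
  have i3 : Integrable fun x => bracketDecay r x + bracketDecay r (ξ - x) := hint.add i1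
  have hinner : ∀ x : ℝ, (∫ t : ℝ, |ξ|^2 * (1 + |ξ|) ^ (2*a) /
      ((1 + |τ + ξ^5|) ^ p * (1 + |t + x^2|) ^ p * (1 + |ξ - x|) ^ r *
        (1 + |τ - t + (ξ - x)^2|) ^ p * (1 + |x|) ^ r)) ≤
      K * reducedMultiplier p q r a ξ τ x := by
    intro x
    have hfact : ∀ t : ℝ, |ξ|^2 * (1 + |ξ|) ^ (2*a) /
      ((1 + |τ + ξ^5|) ^ p * (1 + |t + x^2|) ^ p * (1 + |ξ - x|) ^ r *
        (1 + |τ - t + (ξ - x)^2|) ^ p * (1 + |x|) ^ r) =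
      (|ξ|^2 * (1 + |ξ|) ^ (2*a) * bracketDecay p (τ + ξ ^ 5) *
        (bracketDecay r x * bracketDecay r (ξ - x))) *
        (bracketDecay p (t + x ^ 2) * bracketDecay p (τ + (ξ - x) ^ 2 - t)) := by
      intro t
      rw [show τ + (ξ - x) ^ 2 - t = τ - t + (ξ - x) ^ 2 by ring]
      have hneg : ∀ e y : ℝ, bracketDecay e y = ((1 + |y|) ^ e)⁻¹ := fun e y =>
        Real.rpow_neg (by positivity) e
      simp only [hneg]
      field_simp
    simp only [hfact]
    rw [integral_const_mul]
    refine (mul_le_mul_of_nonneg_left (integral_bracketDecay_mul_le (q := q) (by linarith)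
      (by linarith) (by linarith) (x ^ 2) (τ + (ξ - x) ^ 2)) ?_).trans_eq ?_
    · have h1 := bracketDecay_nonneg p (τ + ξ ^ 5)
      have h2 := bracketDecay_nonneg r x
      have h3 := bracketDecay_nonneg r (ξ - x)
      positivity
    · unfold reducedMultiplier
      ring
  calc _ ≤ ∫ x, K * (C * (bracketDecay r x + bracketDecay r (ξ - x) +
          N⁻¹ * bracketDecay r (x / N))) := by
        refine integral_mono_of_nonneg
          (.of_forall fun x => integral_nonneg fun t => by positivity)
          (((i3.add i2).const_mul C).const_mul K) (.of_forall fun x => ?_)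
        exact (hinner x).trans (mul_le_mul_of_nonneg_left (hNbound x) hK)
    _ = _ := by
        rw [integral_const_mul, integral_const_mul, integral_add i3 i2, integral_add hint i1,
          integral_const_mul, integral_sub_left_eq_self (bracketDecay r) volume ξ,
          Measure.integral_comp_div (bracketDecay r) N, abs_of_pos hN, smul_eq_mul,
          inv_mul_cancel_left₀ hN.ne']
        ring
end

section
/- Define u₀(x) = exp(-(i/(4θ))(x-x₀)²) / (1+x²)^{5/4} for fixed θ > 0 and x₀ ∈ ℝ. Then u₀ is smooth on ℝ, bounded, and u₀ ∈ H^{s}(ℝ) for every s < 2 (i.e. u₀ ∈ H^{2⁻}(ℝ)). -/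
open MeasureTheory FourierTransform

/-- Bounding `Y ^ p` by an exponential for `0 ≤ p ≤ 2`. -/
lemma rpow_le_two_mul_exp {p Y : ℝ} (hp : 0 ≤ p) (hp2 : p ≤ 2) (hY : 0 ≤ Y) :
    Y ^ p ≤ 2 * Real.exp Y := by
  have hq := Real.quadratic_le_exp_of_nonneg hY
  rcases le_total Y 1 with h | h
  · have h1 : Y ^ p ≤ 1 := Real.rpow_le_one hY h hp
    nlinarith [sq_nonneg Y]
  · have h1 : Y ^ p ≤ Y ^ (2 : ℝ) := Real.rpow_le_rpow_of_exponent_le h hp2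
    rw [Real.rpow_two] at h1
    nlinarith

lemma exp_neg_sq_mul_div_le {a p t : ℝ} (ha : 0 < a) (hp : 0 ≤ p) (hp2 : p ≤ 2) (ht : 0 < t)
    (η : ℝ) :
    Real.exp (-(η ^ 2 * (t / (t ^ 2 + a ^ 2)))) ≤
      2 * Real.exp (1 / (2 * a)) * (1 + η ^ 2) ^ (-p) *
        (t ^ (-p) * (1 + a ^ 2 + t ^ 2) ^ 2) := by
  set w := t / (t ^ 2 + a ^ 2) with hw
  have hq : 0 < t ^ 2 + a ^ 2 := by positivity
  have hw0 : 0 < w := by positivity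
  have hw1 : w ≤ 1 / (2 * a) := by
    rw [hw, div_le_div_iff₀ hq (by positivity)]
    nlinarith [sq_nonneg (t - a)]
  have hη : 0 < 1 + η ^ 2 := by positivity
  have hY := rpow_le_two_mul_exp hp hp2 (Y := (1 + η ^ 2) * w) (by positivity)
  have hwp : w ^ (-p) ≤ t ^ (-p) * (1 + a ^ 2 + t ^ 2) ^ 2 := by
    rw [hw, Real.div_rpow ht.le hq.le, Real.rpow_neg hq.le, div_inv_eq_mul]
    gcongr
    calc (t ^ 2 + a ^ 2) ^ p ≤ (1 + a ^ 2 + t ^ 2) ^ p := by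
          apply Real.rpow_le_rpow hq.le _ hp
          linarith
      _ ≤ (1 + a ^ 2 + t ^ 2) ^ (2 : ℝ) :=
          Real.rpow_le_rpow_of_exponent_le (by nlinarith [sq_nonneg a, sq_nonneg t]) hp2
      _ = _ := Real.rpow_two _
  have hYp : 0 < ((1 + η ^ 2) * w) ^ p := by positivity
  calc Real.exp (-(η ^ 2 * w)) = Real.exp w * (Real.exp ((1 + η ^ 2) * w))⁻¹ := by
        rw [← Real.exp_neg, ← Real.exp_add]; congr 1; ring
    _ ≤ Real.exp (1 / (2 * a)) * (2 * (((1 + η ^ 2) * w) ^ p)⁻¹) := by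
        gcongr
        rw [inv_le_iff_one_le_mul₀ (Real.exp_pos _)]
        rw [← div_eq_mul_inv, div_mul_eq_mul_div, le_div_iff₀ hYp]
        linarith
    _ = 2 * Real.exp (1 / (2 * a)) * (1 + η ^ 2) ^ (-p) * w ^ (-p) := by
        rw [Real.mul_rpow hη.le hw0.le, Real.rpow_neg hη.le, Real.rpow_neg hw0.le]
        field_simp
    _ ≤ _ := by gcongr

lemma integrableOn_rpow_mul_exp_mul_sq (A : ℝ) {p : ℝ} (hp : p < 5 / 4) :
    IntegrableOn (fun t : ℝ => t ^ ((1 : ℝ) / 4) * Real.exp (-t) * (t ^ (-p) * (A + t ^ 2) ^ 2))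
      (Set.Ioi 0) := by
  have h1 := (Real.GammaIntegral_convergent (s := 5 / 4 - p) (by linarith)).const_mul (A ^ 2)
  have h2 := (Real.GammaIntegral_convergent (s := 13 / 4 - p) (by linarith)).const_mul (2 * A)
  have h3 := Real.GammaIntegral_convergent (s := 21 / 4 - p) (by linarith)
  refine IntegrableOn.congr_fun ((h1.add h2).add h3) ?_ measurableSet_Ioi
  intro t ht
  have ht : 0 < t := ht
  have e1 : t ^ (5 / 4 - p - 1) = t ^ ((1 : ℝ) / 4) * t ^ (-p) := by
    rw [← Real.rpow_add ht]; congr 1; ring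
  have e2 : t ^ (13 / 4 - p - 1) = t ^ ((1 : ℝ) / 4) * t ^ (-p) * t ^ 2 := by
    rw [← Real.rpow_two, ← Real.rpow_add ht, ← Real.rpow_add ht]; congr 1; ring
  have e3 : t ^ (21 / 4 - p - 1) = t ^ ((1 : ℝ) / 4) * t ^ (-p) * t ^ 4 := by
    rw [← Real.rpow_natCast t 4, ← Real.rpow_add ht, ← Real.rpow_add ht]; congr 1; push_cast; ring
  simp only [Pi.add_apply, e1, e2, e3]
  ring

/-- The oscillating Gaussian chirp damped by `(1 + x²)^(-5/4)`. -/
noncomputable def dampedChirp (a x₀ : ℝ) (x : ℝ) : ℂ :=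
  Complex.exp (-(Complex.I * a) * ((x : ℂ) - x₀) ^ 2) / ((1 + x ^ 2) ^ ((5 : ℝ) / 4) : ℝ)

lemma norm_dampedChirp (a x₀ x : ℝ) :
    ‖dampedChirp a x₀ x‖ = (1 + x ^ 2) ^ (-((5 : ℝ) / 4)) := by
  have hx : (0 : ℝ) < 1 + x ^ 2 := by positivity
  have h : -(Complex.I * a) * ((x : ℂ) - x₀) ^ 2 = ((-(a * (x - x₀) ^ 2) : ℝ) : ℂ) * Complex.I := by
    push_cast; ring
  rw [dampedChirp, norm_div, h, Complex.norm_exp_ofReal_mul_I, Complex.norm_real, Real.norm_eq_abs,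
    abs_of_pos (by positivity), Real.rpow_neg hx.le, one_div]

lemma contDiff_dampedChirp (a x₀ : ℝ) : ContDiff ℝ (⊤ : ℕ∞) (dampedChirp a x₀) := by
  have h1 : ContDiff ℝ (⊤ : ℕ∞) (fun x : ℝ => (x : ℂ)) := Complex.ofRealCLM.contDiff
  have h2 : ContDiff ℝ (⊤ : ℕ∞) (fun x : ℝ => (1 + x ^ 2) ^ ((5 : ℝ) / 4)) :=
    ContDiff.rpow_const_of_ne (by fun_prop) (fun x => by positivity)
  have h3 : ContDiff ℝ (⊤ : ℕ∞) (fun x : ℝ => (((1 + x ^ 2) ^ ((5 : ℝ) / 4) : ℝ) : ℂ)) :=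
    Complex.ofRealCLM.contDiff.comp h2
  have h4 : ContDiff ℝ (⊤ : ℕ∞) (fun x : ℝ => -(Complex.I * a) * ((x : ℂ) - x₀) ^ 2) :=
    contDiff_const.mul ((h1.sub contDiff_const).pow 2)
  unfold dampedChirp
  simp_rw [div_eq_mul_inv]
  refine h4.cexp.mul (h3.inv fun x => ?_)
  rw [Complex.ofReal_ne_zero]
  positivity

lemma integrable_dampedChirp (a x₀ : ℝ) : Integrable (dampedChirp a x₀) := by
  have h := integrable_rpow_neg_one_add_norm_sq (E := ℝ) (μ := volume) (r := 5 / 2)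
    (by norm_num)
  refine h.mono' (contDiff_dampedChirp a x₀).continuous.aestronglyMeasurable
    (Filter.Eventually.of_forall fun x => le_of_eq ?_)
  rw [norm_dampedChirp, Real.norm_eq_abs, sq_abs]
  norm_num

/-- The unimodular factor in the Fourier integral of `dampedChirp`. -/
noncomputable def chirpPhase (a x₀ ξ x : ℝ) : ℂ :=
  Complex.exp (((-2 * Real.pi * x * ξ : ℝ) : ℂ) * Complex.I) *
    Complex.exp (-(Complex.I * a) * ((x : ℂ) - x₀) ^ 2)

lemma norm_chirpPhase (a x₀ ξ x : ℝ) : ‖chirpPhase a x₀ ξ x‖ = 1 := by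
  have h : -(Complex.I * a) * ((x : ℂ) - x₀) ^ 2 = ((-(a * (x - x₀) ^ 2) : ℝ) : ℂ) * Complex.I := by
    push_cast; ring
  rw [chirpPhase, norm_mul, h, Complex.norm_exp_ofReal_mul_I, Complex.norm_exp_ofReal_mul_I,
    one_mul]

lemma continuous_chirpPhase (a x₀ ξ : ℝ) : Continuous (chirpPhase a x₀ ξ) := by
  unfold chirpPhase; fun_prop

lemma integral_gammaKernel (x : ℝ) :
    ∫ t in Set.Ioi (0 : ℝ), t ^ ((1 : ℝ) / 4) * Real.exp (-((1 + x ^ 2) * t)) =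
      (1 + x ^ 2) ^ (-((5 : ℝ) / 4)) * Real.Gamma (5 / 4) := by
  have h := Real.integral_rpow_mul_exp_neg_mul_Ioi (a := 5 / 4) (r := 1 + x ^ 2) (by norm_num)
    (by positivity)
  rw [one_div, Real.inv_rpow (by positivity), ← Real.rpow_neg (by positivity)] at h
  rw [← h]
  norm_num

lemma integrableOn_gammaKernel (x : ℝ) :
    IntegrableOn (fun t : ℝ => t ^ ((1 : ℝ) / 4) * Real.exp (-((1 + x ^ 2) * t))) (Set.Ioi 0) := by
  by_contra h
  have h1 := integral_gammaKernel x
  rw [integral_undef h] at h1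
  have : 0 < (1 + x ^ 2) ^ (-((5 : ℝ) / 4)) * Real.Gamma (5 / 4) :=
    mul_pos (by positivity) (Real.Gamma_pos_of_pos (by norm_num))
  linarith

/-- The Fourier transform of `dampedChirp` as a superposition of Gaussian integrals. -/
lemma fourier_dampedChirp_mul_Gamma (a x₀ ξ : ℝ) :
    𝓕 (dampedChirp a x₀) ξ * (Real.Gamma (5 / 4) : ℝ) =
      ∫ t in Set.Ioi (0 : ℝ), ∫ x : ℝ, chirpPhase a x₀ ξ x *
        ((t ^ ((1 : ℝ) / 4) * Real.exp (-((1 + x ^ 2) * t)) : ℝ) : ℂ) := by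
  have hpos : ∀ x : ℝ, ∀ t ∈ Set.Ioi (0 : ℝ),
      ‖chirpPhase a x₀ ξ x * ((t ^ ((1 : ℝ) / 4) * Real.exp (-((1 + x ^ 2) * t)) : ℝ) : ℂ)‖ =
        t ^ ((1 : ℝ) / 4) * Real.exp (-((1 + x ^ 2) * t)) := by
    intro x t ht
    have ht : 0 < t := ht
    rw [norm_mul, norm_chirpPhase, one_mul, Complex.norm_real, Real.norm_eq_abs,
      abs_of_pos (by positivity)]
  rw [← integral_integral_swap]
  · rw [Real.fourier_real_eq_integral_exp_smul, ← integral_mul_const]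
    congr 1
    ext x
    rw [integral_const_mul, integral_complex_ofReal, integral_gammaKernel, chirpPhase, dampedChirp,
      Real.rpow_neg (by positivity)]
    push_cast
    rw [smul_eq_mul]
    ring
  · rw [integrable_prod_iff]
    · refine ⟨Filter.Eventually.of_forall fun x => ?_, ?_⟩
      · exact (Integrable.ofReal (𝕜 := ℂ) (integrableOn_gammaKernel x)).const_mul
          (chirpPhase a x₀ ξ x)
      · refine ((integrable_dampedChirp a x₀).norm.mul_const (Real.Gamma (5 / 4))).congr
          (Filter.Eventually.of_forall fun x => ?_)
        simp only [Function.uncurry_apply_pair]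
        rw [setIntegral_congr_fun measurableSet_Ioi (hpos x), integral_gammaKernel,
          norm_dampedChirp]
    · have hm : Measurable (Function.uncurry fun x t : ℝ => chirpPhase a x₀ ξ x *
          ((t ^ ((1 : ℝ) / 4) * Real.exp (-((1 + x ^ 2) * t)) : ℝ) : ℂ)) := by
        have := (continuous_chirpPhase a x₀ ξ).measurable
        unfold Function.uncurry
        fun_prop
      exact hm.aestronglyMeasurable

lemma norm_integral_chirpPhase_le {a : ℝ} (ha : 0 < a) (x₀ ξ : ℝ) {t : ℝ} (ht : 0 < t) :
    ‖∫ x : ℝ, chirpPhase a x₀ ξ x *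
        ((t ^ ((1 : ℝ) / 4) * Real.exp (-((1 + x ^ 2) * t)) : ℝ) : ℂ)‖ ≤
      t ^ ((1 : ℝ) / 4) * Real.exp (-t) * ((Real.pi / a) ^ ((1 : ℝ) / 2) *
        Real.exp (-((Real.pi * ξ - a * x₀) ^ 2 * (t / (t ^ 2 + a ^ 2))))) := by
  set b : ℂ := -(t + a * Complex.I) with hb
  have hbre : b.re < 0 := by simp [hb, ht]
  set c : ℂ := -2 * Complex.I * ((Real.pi * ξ - a * x₀ : ℝ) : ℂ) with hc
  set d : ℂ := ((-(a * x₀ ^ 2) : ℝ) : ℂ) * Complex.I with hd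
  have heq : ∀ x : ℝ, chirpPhase a x₀ ξ x *
        ((t ^ ((1 : ℝ) / 4) * Real.exp (-((1 + x ^ 2) * t)) : ℝ) : ℂ) =
      ((t ^ ((1 : ℝ) / 4) * Real.exp (-t) : ℝ) : ℂ) *
        Complex.exp (b * (x : ℂ) ^ 2 + c * x + d) := by
    intro x
    have : Real.exp (-((1 + x ^ 2) * t)) = Real.exp (-t) * Real.exp (-(x ^ 2 * t)) := by
      rw [← Real.exp_add]; congr 1; ring
    rw [this, chirpPhase, ← Complex.exp_add]
    have h2 : Complex.exp (b * (x : ℂ) ^ 2 + c * x + d) =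
        Complex.exp (((-2 * Real.pi * x * ξ : ℝ) : ℂ) * Complex.I +
          -(Complex.I * a) * ((x : ℂ) - x₀) ^ 2) * Complex.exp ((-(x ^ 2 * t) : ℝ) : ℂ) := by
      rw [← Complex.exp_add]; congr 1; rw [hb, hc, hd]; push_cast; ring
    rw [h2, ← Complex.ofReal_exp]
    push_cast
    ring
  simp_rw [heq]
  rw [integral_const_mul, integral_cexp_quadratic hbre, norm_mul, norm_mul, Complex.norm_real,
    Real.norm_eq_abs, abs_of_pos (by positivity), Complex.norm_exp]
  have hb0 : b ≠ 0 := fun h => by simp [h] at hbre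
  have hbn : a ≤ ‖-b‖ := by
    have := Complex.abs_im_le_norm (-b)
    simpa [hb, abs_of_pos ha] using this
  have hpow : ‖((Real.pi : ℂ) / -b) ^ (1 / 2 : ℂ)‖ ≤ (Real.pi / a) ^ ((1 : ℝ) / 2) := by
    have h12 : (1 / 2 : ℂ) = ((1 / 2 : ℝ) : ℂ) := by push_cast; rfl
    rw [h12, Complex.norm_cpow_real, norm_div, Complex.norm_real, Real.norm_eq_abs,
      abs_of_pos Real.pi_pos]
    gcongr
  have hre : (d - c ^ 2 / (4 * b)).re =
      -((Real.pi * ξ - a * x₀) ^ 2 * (t / (t ^ 2 + a ^ 2))) := by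
    have h1 : d - c ^ 2 / (4 * b) =
        d + (((Real.pi * ξ - a * x₀) ^ 2 : ℝ) : ℂ) * b⁻¹ := by
      rw [hc]
      field_simp
      push_cast
      linear_combination (-4 * (Real.pi * ξ - a * x₀ : ℂ) ^ 2) * Complex.I_sq
    have h2 : (b⁻¹).re = -(t / (t ^ 2 + a ^ 2)) := by
      rw [Complex.inv_re, Complex.normSq_apply]
      simp [hb]
      ring
    have h3 : d.re = 0 := by rw [hd, Complex.re_ofReal_mul, Complex.I_re, mul_zero]
    rw [h1, Complex.add_re, h3, Complex.re_ofReal_mul, h2]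
    ring
  rw [hre]
  gcongr

lemma exists_norm_fourier_dampedChirp_le {a : ℝ} (ha : 0 < a) (x₀ : ℝ) {p : ℝ} (hp : 0 ≤ p)
    (hp' : p < 5 / 4) :
    ∃ C : ℝ, ∀ ξ : ℝ, ‖𝓕 (dampedChirp a x₀) ξ‖ ≤
      C * (1 + (Real.pi * ξ - a * x₀) ^ 2) ^ (-p) := by
  have hΓ : 0 < Real.Gamma (5 / 4) := Real.Gamma_pos_of_pos (by norm_num)
  have hint := integrableOn_rpow_mul_exp_mul_sq (1 + a ^ 2) hp'
  set J := ∫ t in Set.Ioi (0 : ℝ), t ^ ((1 : ℝ) / 4) * Real.exp (-t) *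
    (t ^ (-p) * (1 + a ^ 2 + t ^ 2) ^ 2)
  set K := (Real.pi / a) ^ ((1 : ℝ) / 2) * (2 * Real.exp (1 / (2 * a)))
  refine ⟨K * J / Real.Gamma (5 / 4), fun ξ => ?_⟩
  set B := (1 + (Real.pi * ξ - a * x₀) ^ 2) ^ (-p)
  have hle : ‖𝓕 (dampedChirp a x₀) ξ * (Real.Gamma (5 / 4) : ℝ)‖ ≤ K * B * J := by
    rw [fourier_dampedChirp_mul_Gamma, ← integral_const_mul]
    refine norm_integral_le_of_norm_le (hint.const_mul (K * B))
      ((ae_restrict_iff' measurableSet_Ioi).2 (Filter.Eventually.of_forall fun t ht => ?_))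
    have ht : 0 < t := ht
    refine (norm_integral_chirpPhase_le ha x₀ ξ ht).trans ?_
    calc _ ≤ t ^ ((1 : ℝ) / 4) * Real.exp (-t) * ((Real.pi / a) ^ ((1 : ℝ) / 2) *
          (2 * Real.exp (1 / (2 * a)) * B * (t ^ (-p) * (1 + a ^ 2 + t ^ 2) ^ 2))) := by
          gcongr
          exact exp_neg_sq_mul_div_le ha hp (by linarith) ht _
      _ = _ := by ring
  rw [norm_mul, Complex.norm_real, Real.norm_eq_abs, abs_of_pos hΓ] at hle
  rw [div_mul_eq_mul_div, le_div_iff₀ hΓ]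
  linarith

/-- An affine change of frequency distorts the weight `1 + |ξ|` by at most a constant. -/
lemma sq_one_add_abs_le (y ξ : ℝ) :
    (1 + |ξ|) ^ 2 ≤ 4 * (1 + y ^ 2) * (1 + (Real.pi * ξ - y) ^ 2) := by
  have hπ : 9 ≤ Real.pi ^ 2 := by nlinarith [Real.pi_gt_three]
  have h1 : ξ ^ 2 * 9 ≤ (Real.pi * ξ) ^ 2 := by
    rw [mul_pow]; nlinarith [sq_nonneg ξ]
  have h2 : (Real.pi * ξ) ^ 2 ≤ 2 * y ^ 2 + 2 * (Real.pi * ξ - y) ^ 2 := by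
    nlinarith [sq_nonneg (Real.pi * ξ - y - y)]
  have h3 : (1 + |ξ|) ^ 2 ≤ 2 + 2 * ξ ^ 2 := by
    nlinarith [sq_abs ξ, sq_nonneg (|ξ| - 1)]
  nlinarith [mul_nonneg (sq_nonneg y) (sq_nonneg (Real.pi * ξ - y)), sq_nonneg y,
    sq_nonneg (Real.pi * ξ - y)]

lemma continuous_fourier_dampedChirp (a x₀ : ℝ) : Continuous (𝓕 (dampedChirp a x₀)) :=
  VectorFourier.fourierIntegral_continuous Real.continuous_fourierChar
    (L := innerₗ ℝ) continuous_inner (integrable_dampedChirp a x₀)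

lemma integrable_rpow_mul_fourier_dampedChirp {a : ℝ} (ha : 0 < a) (x₀ : ℝ) {s : ℝ} (hs : s < 2) :
    Integrable (fun ξ : ℝ => (1 + |ξ|) ^ (2 * s) * ‖𝓕 (dampedChirp a x₀) ξ‖ ^ 2) := by
  obtain ⟨p, hp1, hp2⟩ := exists_between (a₁ := max 0 ((2 * s + 1) / 4)) (a₂ := 5 / 4)
    (max_lt (by norm_num) (by linarith))
  have hp : 0 < p := (le_max_left _ _).trans_lt hp1
  have hps : (2 * s + 1) / 4 < p := (le_max_right _ _).trans_lt hp1
  obtain ⟨C, hC⟩ := exists_norm_fourier_dampedChirp_le ha x₀ hp.le hp2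
  set D := 4 * (1 + (a * x₀) ^ 2)
  have hD : 0 < D := by positivity
  have hw := (integrable_one_add_norm (E := ℝ) (μ := volume) (r := 4 * p - 2 * s)
    (by norm_num; linarith)).const_mul (C ^ 2 * (D ^ p) ^ 2)
  have hm : AEStronglyMeasurable
      (fun ξ : ℝ => (1 + |ξ|) ^ (2 * s) * ‖𝓕 (dampedChirp a x₀) ξ‖ ^ 2) := by
    have := (continuous_fourier_dampedChirp a x₀).measurable
    exact Measurable.aestronglyMeasurable (by fun_prop)
  refine hw.mono' hm (Filter.Eventually.of_forall fun ξ => ?_)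
  have h1 : 0 < 1 + |ξ| := by positivity
  have hE : 0 < 1 + (Real.pi * ξ - a * x₀) ^ 2 := by positivity
  have hB : (1 + (Real.pi * ξ - a * x₀) ^ 2) ^ (-p) ≤ D ^ p * (1 + |ξ|) ^ (-(2 * p)) := by
    have h := Real.rpow_le_rpow (by positivity) (sq_one_add_abs_le (a * x₀) ξ) hp.le
    rw [Real.mul_rpow hD.le hE.le, ← Real.rpow_natCast, ← Real.rpow_mul h1.le] at h
    rw [Real.rpow_neg hE.le, Real.rpow_neg h1.le, ← div_eq_mul_inv, le_div_iff₀ (by positivity),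
      inv_mul_le_iff₀ (by positivity)]
    push_cast at h
    linarith
  have hC0 : 0 ≤ C := nonneg_of_mul_nonneg_left ((norm_nonneg _).trans (hC ξ)) (by positivity)
  have hn : ‖𝓕 (dampedChirp a x₀) ξ‖ ≤ C * (D ^ p * (1 + |ξ|) ^ (-(2 * p))) :=
    (hC ξ).trans (by gcongr)
  rw [Real.norm_eq_abs, abs_of_nonneg (by positivity), Real.norm_eq_abs]
  calc _ ≤ (1 + |ξ|) ^ (2 * s) * (C * (D ^ p * (1 + |ξ|) ^ (-(2 * p)))) ^ 2 := by gcongr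
    _ = C ^ 2 * (D ^ p) ^ 2 *
        ((1 + |ξ|) ^ (2 * s) * ((1 + |ξ|) ^ (-(2 * p)) * (1 + |ξ|) ^ (-(2 * p)))) := by ring
    _ = _ := by
      rw [← Real.rpow_add h1, ← Real.rpow_add h1]
      congr 2
      ring

theorem stmt_18 (θ x₀ : ℝ) (hθ : 0 < θ) :
    let u₀ : ℝ → ℂ := fun x =>
      Complex.exp (-(Complex.I / (4*θ)) * ((x : ℂ) - x₀)^2) / ((1 + x^2) ^ ((5:ℝ)/4) : ℝ)
    ContDiff ℝ (⊤ : ℕ∞) u₀ ∧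
    (∃ M : ℝ, ∀ x : ℝ, ‖u₀ x‖ ≤ M) ∧
    ∀ s : ℝ, s < 2 →
      Integrable (fun ξ : ℝ => (1 + |ξ|) ^ (2*s) * ‖𝓕 u₀ ξ‖ ^ 2) := by
  intro u₀
  have hu : u₀ = dampedChirp (1 / (4 * θ)) x₀ := by
    funext x
    simp only [u₀, dampedChirp]
    push_cast
    rw [mul_one_div]
  rw [hu]
  refine ⟨contDiff_dampedChirp _ _, ⟨1, fun x => ?_⟩,
    fun s hs => integrable_rpow_mul_fourier_dampedChirp (by positivity) x₀ hs⟩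
  rw [norm_dampedChirp]
  exact Real.rpow_le_one_of_one_le_of_nonpos (by nlinarith [sq_nonneg x]) (by norm_num)
end
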